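/- In the dual setting, the half-plane coloring theorem is equivalent to a ray-stabbing statement: for any finite set R of vertical rays in ℝ² (each either upward or downward), there is a 2-coloring of R such that every non-vertical line intersecting at least three rays of R intersects rays of both colors. -/

import Mathlib

/-- A vertical ray in `ℝ²`: either downward or upward. -/
def IsVRay (r : Set (ℝ × ℝ)) : Prop :=
  ∃ a c : ℝ, r = {p : ℝ × ℝ | p.1 = a ∧ p.2 ≤ c} ∨ r = {p : ℝ × ℝ | p.1 = a ∧ c ≤ p.2}

/-- The non-vertical line `y = mx + k` as a subset of the plane. -/
def NVLine (m k : ℝ) : Set (ℝ × ℝ) := {p : ℝ × ℝ | p.2 = m * p.1 + k}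

/-- The bilinear pairing on the plane. -/
def planeDot (v x : ℝ × ℝ) : ℝ := v.1 * x.1 + v.2 * x.2

/-- The determinant of two plane vectors. -/
def planeDet (v w : ℝ × ℝ) : ℝ := v.1 * w.2 - v.2 * w.1

/-- The affine function on the plane with coefficient vector `h`. -/
def affVal (h : ℝ × ℝ × ℝ) (x : ℝ × ℝ) : ℝ := h.1 * x.1 + h.2.1 * x.2 + h.2.2

/-- `v` lies in the triangle spanned by the origin, `a` and `b`, off the edge `ab`. -/
def InnerTriangle (v a b : ℝ × ℝ) : Prop :=
  ∃ α β : ℝ, 0 ≤ α ∧ 0 ≤ β ∧ α + β < 1 ∧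
    v.1 = α * a.1 + β * b.1 ∧ v.2 = α * a.2 + β * b.2

theorem innerTriangle_of_det {f g v w y : ℝ × ℝ}
    (hgw : 1 ≤ planeDot w g) (hgy : planeDot y g < 1) (hfv : 1 ≤ planeDot v f)
    (hfw : planeDot w f < 1) (hfy : 1 ≤ planeDot y f) (hne : planeDet v y ≠ 0)
    (hd : planeDot v f ≤ planeDot v g)
    (hs : 0 ≤ planeDet v w * planeDet v y) : InnerTriangle w v y := by
  set α := planeDet w y / planeDet v y with hα
  set β := planeDet v w / planeDet v y with hβ
  have hβ0 : 0 ≤ β := div_nonneg_iff.2 (mul_nonneg_iff.1 hs)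
  have h1 : w.1 = α * v.1 + β * y.1 := by
    rw [hα, hβ]; field_simp; unfold planeDet; ring
  have h2 : w.2 = α * v.2 + β * y.2 := by
    rw [hα, hβ]; field_simp; unfold planeDet; ring
  have hlin : ∀ x, planeDot w x = α * planeDot v x + β * planeDot y x := by
    intro x; unfold planeDot; rw [h1, h2]; ring
  have hf := hlin f
  have hg := hlin g
  have hα0 : 0 ≤ α := by
    by_contra! hneg
    nlinarith
  exact ⟨α, β, hα0, hβ0, by nlinarith, h1, h2⟩

theorem innerTriangle_of_middle {f g u v w y : ℝ × ℝ} (hgu : 1 ≤ planeDot u g)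
    (hgv : 1 ≤ planeDot v g) (hgw : 1 ≤ planeDot w g) (hgy : planeDot y g < 1)
    (hfu : planeDot u f < 1) (hfv : 1 ≤ planeDot v f) (hfw : planeDot w f < 1)
    (hfy : 1 ≤ planeDot y f) (huv : 0 ≤ planeDet u v) (hvw : 0 ≤ planeDet v w) :
    InnerTriangle u v y ∨ InnerTriangle w v y := by
  have hg : planeDot v g * planeDet u w =
      planeDet v w * planeDot u g + planeDet u v * planeDot w g := by
    unfold planeDot planeDet; ring
  have hf : planeDot v f * planeDet u w =
      planeDet v w * planeDot u f + planeDet u v * planeDot w f := by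
    unfold planeDot planeDet; ring
  have hcross : ∀ a b : ℝ × ℝ, planeDet a b = 0 →
      planeDot a f * planeDot b g = planeDot b f * planeDot a g := by
    intro a b hab
    have : planeDot a f * planeDot b g - planeDot b f * planeDot a g =
        planeDet a b * planeDet f g := by unfold planeDot planeDet; ring
    rw [hab] at this; linarith
  have hd : planeDot v f ≤ planeDot v g := by
    rcases huv.eq_or_lt with h0 | hpos
    · have := hcross u v h0.symm
      nlinarith
    · have huw : 0 < planeDet u w := by
        by_contra! hneg
        nlinarith [mul_nonneg hvw (by linarith : 0 ≤ planeDot u g),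
          mul_pos hpos (by linarith : 0 < planeDot w g),
          mul_nonneg (by linarith : 0 ≤ planeDot v g) (neg_nonneg.2 hneg)]
      have h1 := mul_le_mul_of_nonneg_left (by linarith : planeDot u f ≤ planeDot u g) hvw
      have h2 := mul_le_mul_of_nonneg_left (by linarith : planeDot w f ≤ planeDot w g) huv
      exact le_of_mul_le_mul_right (by linarith) huw
  have hne : planeDet v y ≠ 0 := by
    intro h0
    have := hcross v y h0
    nlinarith
  rcases le_total 0 (planeDet v y) with h | h
  · exact Or.inr (innerTriangle_of_det hgw hgy hfv hfw hfy hne hd (mul_nonneg hvw h))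
  · refine Or.inl (innerTriangle_of_det hgu hgy hfv hfu hfy hne hd ?_)
    have : planeDet v u ≤ 0 := by unfold planeDet at *; linarith
    exact mul_nonneg_of_nonpos_of_nonpos this h

/-- Finitely many points can be split so that every half-plane missing the origin meets the first
part once it holds two points, and the second part once it holds three. -/
theorem exists_hitting_set {ι : Type*} [DecidableEq ι] (S : Finset ι) (n : ι → ℝ × ℝ) :
    ∃ N ⊆ S, ∀ x : ℝ × ℝ,
      (2 ≤ (S.filter fun i => 1 ≤ planeDot (n i) x).card →
        ∃ i ∈ N, 1 ≤ planeDot (n i) x) ∧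
      (3 ≤ (S.filter fun i => 1 ≤ planeDot (n i) x).card →
        ∃ i ∈ S, i ∉ N ∧ 1 ≤ planeDot (n i) x) := by
  classical
  set E := S.filter fun u => ¬ ∃ v ∈ S, ∃ y ∈ S, InnerTriangle (n u) (n v) (n y) with hE
  let P : Finset ι → Prop := fun N => N ⊆ E ∧ ∀ x : ℝ × ℝ,
    2 ≤ (S.filter fun i => 1 ≤ planeDot (n i) x).card → ∃ i ∈ N, 1 ≤ planeDot (n i) x
  have hPE : P E := by
    refine ⟨subset_rfl, fun x hx => ?_⟩
    obtain ⟨i, hi⟩ := Finset.card_pos.1 (by omega : 0 < (S.filter fun i =>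
      1 ≤ planeDot (n i) x).card)
    obtain ⟨hiS, hi1⟩ := Finset.mem_filter.1 hi
    obtain ⟨u, huS, hmax⟩ := S.exists_max_image (fun i => planeDot (n i) x) ⟨i, hiS⟩
    have hu1 : 1 ≤ planeDot (n u) x := hi1.trans (hmax i hiS)
    refine ⟨u, Finset.mem_filter.2 ⟨huS, ?_⟩, hu1⟩
    rintro ⟨v, hv, y, hy, α, β, hα, hβ, hαβ, h1, h2⟩
    have hlin : planeDot (n u) x = α * planeDot (n v) x + β * planeDot (n y) x := by
      unfold planeDot; rw [h1, h2]; ring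
    have hv' := mul_le_mul_of_nonneg_left (hmax v hv) hα
    have hy' := mul_le_mul_of_nonneg_left (hmax y hy) hβ
    nlinarith
  obtain ⟨N, hNP, hmin⟩ : ∃ N, P N ∧ ∀ M, M ⊂ N → ¬ P M := by
    obtain ⟨N, hN, hmin⟩ := WellFounded.has_min (wellFounded_lt (α := Finset ι)) {N | P N}
      ⟨E, hPE⟩
    exact ⟨N, hN, fun M hM hPM => hmin M hPM hM⟩
  have hNS : N ⊆ S := hNP.1.trans (Finset.filter_subset _ _)
  have hinner : ∀ u ∈ N, ∀ v ∈ S, ∀ y ∈ S, ¬ InnerTriangle (n u) (n v) (n y) :=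
    fun u hu v hv y hy h => (Finset.mem_filter.1 (hNP.1 hu)).2 ⟨v, hv, y, hy, h⟩
  refine ⟨N, hNS, fun x => ⟨hNP.2 x, fun hx => ?_⟩⟩
  by_contra! hno
  have hmem : ∀ i ∈ S, 1 ≤ planeDot (n i) x → i ∈ N := fun i hi h => by
    by_contra hiN
    exact absurd h (not_le.2 (hno i hi hiN))
  have key : ∀ u ∈ N, ∀ v ∈ N, ∀ w ∈ N, u ≠ v → v ≠ w → 1 ≤ planeDot (n u) x →
      1 ≤ planeDot (n v) x → 1 ≤ planeDot (n w) x → 0 ≤ planeDet (n u) (n v) →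
      0 ≤ planeDet (n v) (n w) → False := by
    intro u hu v hv w hw huv hvw hu1 hv1 hw1 hduv hdvw
    have hnot := hmin (N.erase v) (Finset.erase_ssubset hv)
    have : ∃ f : ℝ × ℝ, 2 ≤ (S.filter fun i => 1 ≤ planeDot (n i) f).card ∧
        ∀ i ∈ N.erase v, planeDot (n i) f < 1 := by
      by_contra! hcon
      exact hnot ⟨(Finset.erase_subset _ _).trans hNP.1, hcon⟩
    obtain ⟨f, hf2, hf⟩ := this
    obtain ⟨i, hiN, hi⟩ := hNP.2 f hf2
    have hfv : 1 ≤ planeDot (n v) f := by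
      by_cases hiv : i = v
      · exact hiv ▸ hi
      · exact absurd hi (not_le.2 (hf i (Finset.mem_erase.2 ⟨hiv, hiN⟩)))
    obtain ⟨y, hy, hyv⟩ := Finset.exists_mem_ne (by omega : 1 < (S.filter fun i =>
      1 ≤ planeDot (n i) f).card) v
    obtain ⟨hyS, hfy⟩ := Finset.mem_filter.1 hy
    have hyN : y ∉ N := fun h => absurd hfy (not_le.2 (hf y (Finset.mem_erase.2 ⟨hyv, h⟩)))
    rcases innerTriangle_of_middle hu1 hv1 hw1 (hno y hyS hyN)
      (hf u (Finset.mem_erase.2 ⟨huv, hu⟩)) hfv (hf w (Finset.mem_erase.2 ⟨hvw.symm, hw⟩))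
      hfy hduv hdvw with h | h
    · exact hinner u hu v (hNS hv) y hyS h
    · exact hinner w hw v (hNS hv) y hyS h
  obtain ⟨u, v, w, hu, hv, hw, huv, huw, hvw⟩ := Finset.two_lt_card_iff.1 hx
  simp only [Finset.mem_filter] at hu hv hw
  have hu' := hmem u hu.1 hu.2
  have hv' := hmem v hv.1 hv.2
  have hw' := hmem w hw.1 hw.2
  have hanti : ∀ a b : ℝ × ℝ, 0 ≤ planeDet a b ∨ 0 ≤ planeDet b a := fun a b => by
    unfold planeDet
    rcases le_total (a.1 * b.2) (a.2 * b.1) with h | h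
    · right; linarith
    · left; linarith
  rcases hanti (n u) (n v) with h1 | h1 <;> rcases hanti (n v) (n w) with h2 | h2 <;>
    rcases hanti (n u) (n w) with h3 | h3 <;>
    grind

/-- The members of the family of closed half-planes `0 ≤ affVal (h i)` that contain `x`. -/
noncomputable def cellOf {ι : Type*} [Fintype ι] (h : ι → ℝ × ℝ × ℝ) (x : ℝ × ℝ) : Finset ι :=
  Finset.univ.filter fun i => 0 ≤ affVal (h i) x

theorem mem_cellOf {ι : Type*} [Fintype ι] {h : ι → ℝ × ℝ × ℝ} {x : ℝ × ℝ} {i : ι} :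
    i ∈ cellOf h x ↔ 0 ≤ affVal (h i) x := by
  simp [cellOf]

theorem affVal_neg_of_notMem_cellOf {ι : Type*} [Fintype ι] {h : ι → ℝ × ℝ × ℝ} {x : ℝ × ℝ}
    {i : ι} (hi : i ∉ cellOf h x) : affVal (h i) x < 0 :=
  not_le.1 (mt mem_cellOf.2 hi)

/-- Every cell of at least three half-planes meets both `C` and its complement. -/
def SplitsCells {ι : Type*} [Fintype ι] (h : ι → ℝ × ℝ × ℝ) (C : Finset ι) : Prop :=
  ∀ x, 3 ≤ (cellOf h x).card → (∃ i ∈ cellOf h x, i ∈ C) ∧ ∃ i ∈ cellOf h x, i ∉ C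

/-- The half-planes indexed by `C` cover the plane. -/
def CoversPlane {ι : Type*} [Fintype ι] (h : ι → ℝ × ℝ × ℝ) (C : Finset ι) : Prop :=
  ∀ x, ∃ i ∈ cellOf h x, i ∈ C

theorem exists_splitsCells_of_card_le_one {ι : Type*} [Fintype ι] (h : ι → ℝ × ℝ × ℝ)
    {q : ℝ × ℝ} (hq : (cellOf h q).card ≤ 1) : ∃ C, SplitsCells h C := by
  classical
  set S := (cellOf h q)ᶜ with hS
  have hneg : ∀ i ∈ S, affVal (h i) q < 0 := fun i hi =>
    affVal_neg_of_notMem_cellOf (Finset.mem_compl.1 hi)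
  obtain ⟨N, hNS, hN⟩ := exists_hitting_set S
    fun i => ((h i).1 / -affVal (h i) q, (h i).2.1 / -affVal (h i) q)
  have hiff : ∀ i ∈ S, ∀ x : ℝ × ℝ,
      1 ≤ planeDot ((h i).1 / -affVal (h i) q, (h i).2.1 / -affVal (h i) q) (x - q) ↔
        i ∈ cellOf h x := by
    intro i hi x
    have hpos : 0 < -affVal (h i) q := neg_pos.2 (hneg i hi)
    have : planeDot ((h i).1 / -affVal (h i) q, (h i).2.1 / -affVal (h i) q) (x - q) =
        (affVal (h i) x - affVal (h i) q) / -affVal (h i) q := by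
      simp only [planeDot, affVal, Prod.fst_sub, Prod.snd_sub]; ring
    rw [this, le_div_iff₀ hpos, mem_cellOf]
    constructor <;> intro <;> linarith
  have hfilter : ∀ x : ℝ × ℝ, (S.filter fun i => 1 ≤ planeDot
      ((h i).1 / -affVal (h i) q, (h i).2.1 / -affVal (h i) q) (x - q)) = cellOf h x ∩ S := by
    intro x
    ext i
    simp only [Finset.mem_filter, Finset.mem_inter]
    exact ⟨fun hi => ⟨(hiff i hi.1 x).1 hi.2, hi.1⟩, fun hi => ⟨hi.2, (hiff i hi.2 x).2 hi.1⟩⟩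
  refine ⟨N, fun x hx => ?_⟩
  have hsplit : (cellOf h x ∩ S).card + (cellOf h x ∩ cellOf h q).card = (cellOf h x).card := by
    rw [hS, ← Finset.sdiff_eq_inter_compl, Finset.card_sdiff_add_card_inter]
  have hle := Finset.card_le_card (Finset.inter_subset_right : cellOf h x ∩ cellOf h q ⊆ _)
  have hNx := hN (x - q)
  rw [hfilter] at hNx
  constructor
  · obtain ⟨i, hi, hi1⟩ := hNx.1 (by omega)
    exact ⟨i, (hiff i (hNS hi) x).1 hi1, hi⟩
  · by_cases h0 : (cellOf h x ∩ cellOf h q).Nonempty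
    · obtain ⟨i, hi⟩ := h0
      obtain ⟨hix, hiq⟩ := Finset.mem_inter.1 hi
      exact ⟨i, hix, fun hiN => Finset.mem_compl.1 (hNS hiN) hiq⟩
    · rw [Finset.not_nonempty_iff_eq_empty] at h0
      rw [h0, Finset.card_empty] at hsplit
      obtain ⟨i, hi, hiN, hi1⟩ := hNx.2 (by omega)
      exact ⟨i, (hiff i hi x).1 hi1, hiN⟩

theorem affVal_convex_neg (h : ℝ × ℝ × ℝ) : Convex ℝ {x | affVal h x < 0} := by
  intro x hx y hy a b ha hb hab
  simp only [Set.mem_ofPred_eq] at *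
  have : affVal h (a • x + b • y) = a * affVal h x + b * affVal h y := by
    simp only [affVal, Prod.fst_add, Prod.snd_add, Prod.smul_fst, Prod.smul_snd, smul_eq_mul]
    linear_combination -h.2.2 * hab
  rw [this]
  rcases ha.eq_or_lt with rfl | ha
  · have : b = 1 := by linarith
    subst this; linarith
  · nlinarith

theorem CoversPlane.exists_card_le_three {ι : Type*} [Fintype ι] {h : ι → ℝ × ℝ × ℝ}
    {C : Finset ι} (hC : CoversPlane h C) : ∃ T ⊆ C, T.card ≤ 3 ∧ CoversPlane h T := by
  by_contra! hno
  obtain ⟨x, hx⟩ := Convex.helly_theorem' (𝕜 := ℝ) (F := fun i => {x | affVal (h i) x < 0})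
    (s := C) (fun i _ => affVal_convex_neg (h i)) (by
      intro I hI hcard
      have := hno I hI (by simpa using hcard)
      unfold CoversPlane at this
      push Not at this
      obtain ⟨x, hx⟩ := this
      refine ⟨x, Set.mem_iInter₂.2 fun i hi => ?_⟩
      exact affVal_neg_of_notMem_cellOf fun hix => hx i hix hi)
  obtain ⟨i, hix, hi⟩ := hC x
  have := Set.mem_iInter₂.1 hx i hi
  exact absurd (mem_cellOf.1 hix) (not_le.2 this)

/-- Three half-planes that cover the plane, no two of which do, admit a positive combination of
their functions that is constant. -/
theorem exists_pos_combination_const {A B C : ℝ × ℝ × ℝ}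
    (hABC : ∀ x, 0 ≤ affVal A x ∨ 0 ≤ affVal B x ∨ 0 ≤ affVal C x)
    (hAB : ∃ x, affVal A x < 0 ∧ affVal B x < 0) (hAC : ∃ x, affVal A x < 0 ∧ affVal C x < 0)
    (hBC : ∃ x, affVal B x < 0 ∧ affVal C x < 0) :
    ∃ a b c κ : ℝ, 0 < a ∧ 0 < b ∧ 0 < c ∧
      ∀ x, a * affVal A x + b * affVal B x + c * affVal C x = κ := by
  let φ : ℝ × ℝ → ℝ × ℝ × ℝ := fun x => (affVal A x, affVal B x, affVal C x)
  have hconv : Convex ℝ (Set.range φ) := by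
    rintro _ ⟨x, rfl⟩ _ ⟨y, rfl⟩ s t hs ht hst
    refine ⟨s • x + t • y, ?_⟩
    ext <;>
      simp only [φ, affVal, Prod.fst_add, Prod.snd_add, Prod.smul_fst, Prod.smul_snd,
        smul_eq_mul]
    · linear_combination (-A.2.2) * hst
    · linear_combination (-B.2.2) * hst
    · linear_combination (-C.2.2) * hst
  have hdisj : Disjoint (Set.Iio (0 : ℝ) ×ˢ Set.Iio (0 : ℝ) ×ˢ Set.Iio (0 : ℝ))
      (Set.range φ) := by
    rw [Set.disjoint_left]
    rintro _ ⟨h1, h2, h3⟩ ⟨x, rfl⟩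
    simp only [φ, Set.mem_Iio] at h1 h2 h3
    rcases hABC x with h | h | h <;> linarith
  obtain ⟨f, u, hf1, hf2⟩ := geometric_hahn_banach_open
    ((convex_Iio (0 : ℝ)).prod ((convex_Iio (0 : ℝ)).prod (convex_Iio (0 : ℝ))))
    (isOpen_Iio.prod (isOpen_Iio.prod isOpen_Iio)) hconv hdisj
  set a := f (1, 0, 0) with ha
  set b := f (0, 1, 0) with hb
  set c := f (0, 0, 1) with hc
  have hf : ∀ p q r : ℝ, f (p, q, r) = a * p + b * q + c * r := by
    intro p q r
    have : ((p, q, r) : ℝ × ℝ × ℝ) = p • (1, 0, 0) + q • (0, 1, 0) + r • (0, 0, 1) := by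
      simp
    rw [this, map_add, map_add, map_smul, map_smul, map_smul]
    simp only [smul_eq_mul]; ring
  have hoct : ∀ p q r : ℝ, p < 0 → q < 0 → r < 0 → a * p + b * q + c * r < u :=
    fun p q r hp hq hr => hf p q r ▸ hf1 (p, q, r) ⟨hp, hq, hr⟩
  have hran : ∀ x, u ≤ a * affVal A x + b * affVal B x + c * affVal C x :=
    fun x => hf _ _ _ ▸ hf2 (φ x) ⟨x, rfl⟩
  have hslope : ∀ s t : ℝ, (∀ z : ℝ, u ≤ s * z + t) → s = 0 := by
    intro s t hst
    by_contra hs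
    have := hst ((u - t - 1) / s)
    rw [mul_div_cancel₀ _ hs] at this
    linarith
  have hs1 : a * A.1 + b * B.1 + c * C.1 = 0 := by
    refine hslope _ (a * A.2.2 + b * B.2.2 + c * C.2.2) fun z => (hran (z, 0)).trans_eq ?_
    simp only [affVal]; ring
  have hs2 : a * A.2.1 + b * B.2.1 + c * C.2.1 = 0 := by
    refine hslope _ (a * A.2.2 + b * B.2.2 + c * C.2.2) fun z => (hran (0, z)).trans_eq ?_
    simp only [affVal]; ring
  refine ⟨a, b, c, a * A.2.2 + b * B.2.2 + c * C.2.2, ?_, ?_, ?_, fun x => ?_⟩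
  · obtain ⟨x, h1, h2⟩ := hBC
    have h3 : 0 ≤ affVal A x := by rcases hABC x with h | h | h <;> linarith
    have := hoct (-1) _ _ (by norm_num) h1 h2
    nlinarith [hran x]
  · obtain ⟨x, h1, h2⟩ := hAC
    have h3 : 0 ≤ affVal B x := by rcases hABC x with h | h | h <;> linarith
    have := hoct _ (-1) _ h1 (by norm_num) h2
    nlinarith [hran x]
  · obtain ⟨x, h1, h2⟩ := hAB
    have h3 : 0 ≤ affVal C x := by rcases hABC x with h | h | h <;> linarith
    have := hoct _ _ (-1) h1 h2 (by norm_num)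
    nlinarith [hran x]
  · simp only [affVal]
    linear_combination x.1 * hs1 + x.2 * hs2

theorem CoversPlane.inter_card_ne_one {ι : Type*} [Fintype ι] [DecidableEq ι]
    {h : ι → ℝ × ℝ × ℝ} {T U : Finset ι}
    (hrel : ∀ i j k, i ≠ j → i ≠ k → j ≠ k → CoversPlane h {i, j, k} →
      ∃ a b c κ : ℝ, 0 < a ∧ 0 < b ∧ 0 < c ∧
        ∀ x, a * affVal (h i) x + b * affVal (h j) x + c * affVal (h k) x = κ)
    (hT : CoversPlane h T) (hU : CoversPlane h U) (hT3 : T.card = 3) (hU3 : U.card = 3)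
    (hTx : ∃ x, cellOf h x = T) (hUx : ∃ x, cellOf h x = U) : (T ∩ U).card ≠ 1 := by
  intro hone
  obtain ⟨s, hs⟩ := Finset.card_eq_one.1 hone
  have hsTU : s ∈ T ∩ U := hs ▸ Finset.mem_singleton_self s
  obtain ⟨hsT, hsU⟩ := Finset.mem_inter.1 hsTU
  have htriple : ∀ V : Finset ι, s ∈ V → V.card = 3 → ∃ a b, s ≠ a ∧ s ≠ b ∧ a ≠ b ∧
      V = {s, a, b} := by
    intro V hsV hV
    obtain ⟨a, b, hab, he⟩ := Finset.card_eq_two.1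
      (by rw [Finset.card_erase_of_mem hsV, hV] : (V.erase s).card = 2)
    have hins : V = {s, a, b} := by rw [← he, Finset.insert_erase hsV]
    have hs' : s ∉ ({a, b} : Finset ι) := he ▸ Finset.notMem_erase s V
    simp only [Finset.mem_insert, Finset.mem_singleton, not_or] at hs'
    exact ⟨a, b, hs'.1, hs'.2, hab, hins⟩
  obtain ⟨a, b, hsa, hsb, hab, rfl⟩ := htriple T hsT hT3
  obtain ⟨c, d, hsc, hsd, hcd, rfl⟩ := htriple U hsU hU3
  have hdis : ∀ i, i ∈ ({s, a, b} : Finset ι) → i ∈ ({s, c, d} : Finset ι) → i = s :=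
    fun i h1 h2 => Finset.mem_singleton.1 (hs ▸ Finset.mem_inter.2 ⟨h1, h2⟩)
  obtain ⟨p, α, β, κ, hp, hα, hβ, h1⟩ := hrel s a b hsa hsb hab hT
  obtain ⟨q, γ, δ, κ', hq, hγ, hδ, h2⟩ := hrel s c d hsc hsd hcd hU
  obtain ⟨x, hx⟩ := hTx
  obtain ⟨y, hy⟩ := hUx
  have hax : 0 ≤ affVal (h a) x := mem_cellOf.1 (by simp [hx])
  have hbx : 0 ≤ affVal (h b) x := mem_cellOf.1 (by simp [hx])
  have hcy : 0 ≤ affVal (h c) y := mem_cellOf.1 (by simp [hy])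
  have hdy : 0 ≤ affVal (h d) y := mem_cellOf.1 (by simp [hy])
  have hcx : affVal (h c) x < 0 := affVal_neg_of_notMem_cellOf (hx ▸ fun hc =>
    hsc.symm (hdis c hc (by simp)))
  have hdx : affVal (h d) x < 0 := affVal_neg_of_notMem_cellOf (hx ▸ fun hd =>
    hsd.symm (hdis d hd (by simp)))
  have hay : affVal (h a) y < 0 := affVal_neg_of_notMem_cellOf (hy ▸ fun ha =>
    hsa.symm (hdis a (by simp) ha))
  have hby : affVal (h b) y < 0 := affVal_neg_of_notMem_cellOf (hy ▸ fun hb =>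
    hsb.symm (hdis b (by simp) hb))
  have key : q * α * (affVal (h a) x - affVal (h a) y) + q * β * (affVal (h b) x -
      affVal (h b) y) + p * γ * (affVal (h c) y - affVal (h c) x) +
      p * δ * (affVal (h d) y - affVal (h d) x) = 0 := by
    linear_combination q * (h1 x - h1 y) - p * (h2 x - h2 y)
  have e1 := mul_pos (mul_pos hq hα) (by linarith : 0 < affVal (h a) x - affVal (h a) y)
  have e2 := mul_pos (mul_pos hq hβ) (by linarith : 0 < affVal (h b) x - affVal (h b) y)
  have e3 := mul_pos (mul_pos hp hγ) (by linarith : 0 < affVal (h c) y - affVal (h c) x)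
  have e4 := mul_pos (mul_pos hp hδ) (by linarith : 0 < affVal (h d) y - affVal (h d) x)
  linarith

/-- A finite family of closed half-planes can be split so that every point lying in three of them
lies in one from each part. -/
theorem exists_splitsCells {ι : Type*} [Fintype ι] (h : ι → ℝ × ℝ × ℝ) :
    ∃ C, SplitsCells h C := by
  classical
  by_contra! hno
  have hdepth : ∀ x, 2 ≤ (cellOf h x).card := fun x => by
    by_contra! hx
    obtain ⟨C, hC⟩ := exists_splitsCells_of_card_le_one h (q := x) (by omega)
    exact hno C hC
  have hmono : ∀ C, CoversPlane h C → ∃ x, 3 ≤ (cellOf h x).card ∧ cellOf h x ⊆ C := by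
    intro C hC
    have := hno C
    unfold SplitsCells at this
    push Not at this
    obtain ⟨x, hx, hx'⟩ := this
    exact ⟨x, hx, fun i hi => hx' (hC x) i hi⟩
  have hcard : ∀ C, CoversPlane h C → 3 ≤ C.card := fun C hC => by
    obtain ⟨x, hx, hxC⟩ := hmono C hC
    exact hx.trans (Finset.card_le_card hxC)
  have hsub : ∀ C, CoversPlane h C → ∃ T ⊆ C, T.card = 3 ∧ CoversPlane h T := fun C hC => by
    obtain ⟨T, hTC, hT, hcov⟩ := hC.exists_card_le_three
    exact ⟨T, hTC, le_antisymm hT (hcard T hcov), hcov⟩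
  have hcell : ∀ T, CoversPlane h T → T.card = 3 → ∃ x, cellOf h x = T := fun T hT hT3 => by
    obtain ⟨x, hx, hxT⟩ := hmono T hT
    exact ⟨x, Finset.eq_of_subset_of_card_le hxT (by omega)⟩
  have hrel : ∀ i j k, i ≠ j → i ≠ k → j ≠ k → CoversPlane h {i, j, k} →
      ∃ a b c κ : ℝ, 0 < a ∧ 0 < b ∧ 0 < c ∧
        ∀ x, a * affVal (h i) x + b * affVal (h j) x + c * affVal (h k) x = κ := by
    intro i j k _ _ _ hcov
    have hpair : ∀ i j, ∃ x, affVal (h i) x < 0 ∧ affVal (h j) x < 0 := by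
      intro i j
      by_contra! hcon
      have : CoversPlane h {i, j} := fun x => by
        by_cases hi : i ∈ cellOf h x
        · exact ⟨i, hi, by simp⟩
        · exact ⟨j, mem_cellOf.2 (hcon x (affVal_neg_of_notMem_cellOf hi)), by simp⟩
      have h3 := hcard _ this
      have := Finset.card_le_two (a := i) (b := j)
      omega
    refine exists_pos_combination_const (fun x => ?_) (hpair i j) (hpair i k) (hpair j k)
    obtain ⟨l, hl, hl'⟩ := hcov x
    have := mem_cellOf.1 hl
    simp only [Finset.mem_insert, Finset.mem_singleton] at hl'
    rcases hl' with rfl | rfl | rfl <;> tauto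
  have hinter : ∀ T U, CoversPlane h T → CoversPlane h U → T.card = 3 → U.card = 3 →
      2 ≤ (T ∩ U).card := by
    intro T U hT hU hT3 hU3
    have h1 := CoversPlane.inter_card_ne_one hrel hT hU hT3 hU3 (hcell T hT hT3) (hcell U hU hU3)
    have h0 : (T ∩ U).card ≠ 0 := by
      obtain ⟨x, hx⟩ := hcell T hT hT3
      obtain ⟨i, hi, hiU⟩ := hU x
      exact Finset.card_ne_zero_of_mem (Finset.mem_inter.2 ⟨hx ▸ hi, hiU⟩)
    omega
  have hpair : ∀ U, CoversPlane h U → U.card = 3 → ∀ i ∈ U, ∀ j ∈ U, i ≠ j →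
      ∃ x, cellOf h x = {i, j} := by
    intro U hU hU3 i hi j hj hij
    have hij2 : ({i, j} : Finset ι).card = 2 := Finset.card_pair hij
    have hnot : ¬ CoversPlane h ({i, j} : Finset ι)ᶜ := by
      intro hcov
      obtain ⟨T, hTC, hT3, hT⟩ := hsub _ hcov
      have hle : T ∩ U ⊆ U \ {i, j} := fun k hk => by
        obtain ⟨hkT, hkU⟩ := Finset.mem_inter.1 hk
        exact Finset.mem_sdiff.2 ⟨hkU, Finset.mem_compl.1 (hTC hkT)⟩
      have hd : (U \ {i, j}).card = 1 := by
        rw [Finset.card_sdiff_of_subset (by simp [Finset.insert_subset_iff, hi, hj]), hU3, hij2]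
      have h1 := Finset.card_le_card hle
      have h2 := hinter T U hT hU hT3 hU3
      omega
    unfold CoversPlane at hnot
    push Not at hnot
    obtain ⟨x, hx⟩ := hnot
    refine ⟨x, Finset.eq_of_subset_of_card_le (fun k hk => ?_) (hij2 ▸ hdepth x)⟩
    by_contra hk'
    exact hx k hk (Finset.mem_compl.2 hk')
  have huniv : CoversPlane h Finset.univ := fun x => by
    obtain ⟨i, hi⟩ := Finset.card_pos.1 (by have := hdepth x; omega : 0 < (cellOf h x).card)
    exact ⟨i, hi, Finset.mem_univ i⟩
  obtain ⟨T, -, hT3, hT⟩ := hsub _ huniv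
  obtain ⟨a, p, q, hap, haq, hpq, rfl⟩ := Finset.card_eq_three.1 hT3
  obtain ⟨U, hUa, hU3, hU⟩ := hsub (Finset.univ.erase a) fun x => by
    obtain ⟨i, hi, hia⟩ := Finset.exists_mem_ne (hdepth x) a
    exact ⟨i, hi, by simp [hia]⟩
  have haU : a ∉ U := fun ha => Finset.notMem_erase a _ (hUa ha)
  have hpqU : ({p, q} : Finset ι) ⊆ U := by
    have hle : {a, p, q} ∩ U ⊆ {p, q} := fun k hk => by
      obtain ⟨hk1, hk2⟩ := Finset.mem_inter.1 hk
      rcases Finset.mem_insert.1 hk1 with rfl | hk1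
      · exact absurd hk2 haU
      · exact hk1
    have heq := Finset.eq_of_subset_of_card_le hle
      ((Finset.card_pair hpq).le.trans (hinter _ _ hT hU hT3 hU3))
    exact heq ▸ Finset.inter_subset_right
  obtain ⟨b, hb⟩ := Finset.card_eq_one.1 (by
    rw [Finset.card_sdiff_of_subset hpqU, hU3, Finset.card_pair hpq] : (U \ {p, q}).card = 1)
  have hbU : b ∈ U \ {p, q} := hb ▸ Finset.mem_singleton_self b
  obtain ⟨hbU, hbpq⟩ := Finset.mem_sdiff.1 hbU
  have hUeq : U = {b, p, q} := by
    rw [← Finset.sdiff_union_of_subset hpqU, hb]; rfl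
  simp only [Finset.mem_insert, Finset.mem_singleton, not_or] at hbpq
  obtain ⟨hbp, hbq⟩ := hbpq
  have hab : a ≠ b := fun hab => haU (hab ▸ hbU)
  subst hUeq
  obtain ⟨α, r, s, κ, hα, hr, hs, h1⟩ := hrel a p q hap haq hpq hT
  obtain ⟨β, r', s', κ', hβ, hr', hs', h2⟩ := hrel b p q hbp hbq hpq hU
  have hpairval : ∀ i j, (∃ x, cellOf h x = {i, j}) → ∃ x, 0 ≤ affVal (h i) x ∧
      0 ≤ affVal (h j) x ∧ ∀ k, k ≠ i → k ≠ j → affVal (h k) x < 0 := by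
    rintro i j ⟨x, hx⟩
    exact ⟨x, mem_cellOf.1 (by simp [hx]), mem_cellOf.1 (by simp [hx]), fun k hki hkj =>
      affVal_neg_of_notMem_cellOf (by simp [hx, hki, hkj])⟩
  have key : ∀ x y, r' * α * (affVal (h a) x - affVal (h a) y) +
      r * β * (affVal (h b) y - affVal (h b) x) +
      (r' * s - r * s') * (affVal (h q) x - affVal (h q) y) = 0 := fun x y => by
    linear_combination r' * (h1 x - h1 y) - r * (h2 x - h2 y)
  have hsep : ∀ x y, affVal (h a) y < 0 → affVal (h b) x < 0 → 0 ≤ affVal (h a) x →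
      0 ≤ affVal (h b) y →
      ¬ 0 ≤ (r' * s - r * s') * (affVal (h q) x - affVal (h q) y) := by
    intro x y hay hbx hax hby hq
    have e1 := mul_pos (mul_pos hr' hα) (by linarith : 0 < affVal (h a) x - affVal (h a) y)
    have e2 := mul_pos (mul_pos hr hβ) (by linarith : 0 < affVal (h b) y - affVal (h b) x)
    linarith [key x y]
  rcases le_total 0 (r' * s - r * s') with hsgn | hsgn
  · obtain ⟨x, hax, hqx, hx⟩ := hpairval a q (hpair _ hT hT3 a (by simp) q (by simp) haq)
    obtain ⟨y, hby, hpy, hy⟩ := hpairval b p (hpair _ hU hU3 b (by simp) p (by simp) hbp)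
    have hqy := hy q (Ne.symm hbq) hpq.symm
    exact hsep x y (hy a hab hap) (hx b hab.symm hbq) hax hby
      (mul_nonneg hsgn (by linarith))
  · obtain ⟨x, hax, hpx, hx⟩ := hpairval a p (hpair _ hT hT3 a (by simp) p (by simp) hap)
    obtain ⟨y, hby, hqy, hy⟩ := hpairval b q (hpair _ hU hU3 b (by simp) q (by simp) hbq)
    have hqx := hx q haq.symm hpq.symm
    exact hsep x y (hy a hab haq) (hx b hab.symm hbp) hax hby
      (mul_nonneg_of_nonpos_of_nonpos hsgn (by linarith))

/-- Lines stabbing a vertical ray form, in the coordinates `(m, k)`, a closed half-plane. -/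
theorem IsVRay.exists_affVal {r : Set (ℝ × ℝ)} (hr : IsVRay r) :
    ∃ h : ℝ × ℝ × ℝ, ∀ m k : ℝ, (NVLine m k ∩ r).Nonempty ↔ 0 ≤ affVal h (m, k) := by
  obtain ⟨a, c, rfl | rfl⟩ := hr
  · refine ⟨(-a, -1, c), fun m k => ⟨?_, fun h => ⟨(a, m * a + k), rfl, rfl, ?_⟩⟩⟩
    · rintro ⟨⟨x, y⟩, h1, h2, h3⟩
      simp only [NVLine, Set.mem_ofPred_eq, affVal] at *
      subst h2; linarith
    · simp only [affVal] at *; linarith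
  · refine ⟨(a, 1, -c), fun m k => ⟨?_, fun h => ⟨(a, m * a + k), rfl, rfl, ?_⟩⟩⟩
    · rintro ⟨⟨x, y⟩, h1, h2, h3⟩
      simp only [NVLine, Set.mem_ofPred_eq, affVal] at *
      subst h2; linarith
    · simp only [affVal] at *; linarith

/-- Dual form of the half-plane coloring theorem: any finite set of vertical rays
can be 2-colored so that every non-vertical line intersecting at least three of
the rays intersects rays of both colors. -/
theorem ray_stabbing_coloring
    (R : Set (Set (ℝ × ℝ))) (hfin : R.Finite) (hR : ∀ r ∈ R, IsVRay r) :
    ∃ χ : Set (ℝ × ℝ) → Bool,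
      ∀ m k : ℝ, 3 ≤ {r ∈ R | (NVLine m k ∩ r).Nonempty}.ncard →
        (∃ r ∈ R, (NVLine m k ∩ r).Nonempty ∧ χ r = true) ∧
        (∃ r ∈ R, (NVLine m k ∩ r).Nonempty ∧ χ r = false) := by
  classical
  have := hfin.fintype
  choose h hh using fun r : R => (hR r r.2).exists_affVal
  obtain ⟨C, hC⟩ := exists_splitsCells h
  refine ⟨fun r => decide (∃ hr : r ∈ R, (⟨r, hr⟩ : R) ∈ C), fun m k hmk => ?_⟩
  have himage : {r ∈ R | (NVLine m k ∩ r).Nonempty} =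
      ((cellOf h (m, k)).map (Function.Embedding.subtype _) : Finset (Set (ℝ × ℝ))) := by
    ext r
    simp only [Set.mem_ofPred_eq, Finset.coe_map, Set.mem_image, Finset.mem_coe, mem_cellOf,
      Function.Embedding.subtype_apply]
    constructor
    · rintro ⟨hr, hstab⟩
      exact ⟨⟨r, hr⟩, (hh ⟨r, hr⟩ m k).1 hstab, rfl⟩
    · rintro ⟨r', hr', rfl⟩
      exact ⟨r'.2, (hh r' m k).2 hr'⟩
  rw [himage, Set.ncard_coe_finset, Finset.card_map] at hmk
  obtain ⟨⟨r, hr, hrC⟩, s, hs, hsC⟩ := hC (m, k) hmk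
  refine ⟨⟨r, r.2, (hh r m k).2 (mem_cellOf.1 hr), ?_⟩,
    ⟨s, s.2, (hh s m k).2 (mem_cellOf.1 hs), ?_⟩⟩
  · simpa using hrC
  · simpa using hsC
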